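/- Equality of return values (the paper's Lemma 6.3, in per-thread form): under the hypotheses of the feasibility-of-the-solo-run lemma (step functions fᵢ, guards gᵢ, basis chain B₀, …, Bₙ with guard coverage and wp-closedness, interleaved views τ₀, …, τₙ with interference only preserving true basis predicates, and serial states ρ₀, …, ρₙ with ρᵢ₊₁ = fᵢ ρᵢ and TS_{B₀}(ρ₀) ⊆ TS_{B₀}(τ₀)), suppose additionally that ret : Σ → α is a return-value function such that for every c : α the predicate (fun σ => ret σ = c) is a positive boolean combination over Bₙ (the basis covers the return statement). Then ret ρₙ = ret τₙ: the value returned by the thread in the interleaved execution equals its value in the serial execution. -/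

import Mathlib

/-- A positive boolean combination over a set `S` of predicates on `St`:
built from members of `S` by finitely many pointwise conjunctions and disjunctions. -/
inductive PosComb {St : Type*} (S : Set (St → Prop)) : (St → Prop) → Prop
  | base {p : St → Prop} : p ∈ S → PosComb S p
  | and {p q : St → Prop} : PosComb S p → PosComb S q → PosComb S (fun σ => p σ ∧ q σ)
  | or {p q : St → Prop} : PosComb S p → PosComb S q → PosComb S (fun σ => p σ ∨ q σ)

/-- The set of predicates in `S` that hold at state `σ`. -/
def TS {St : Type*} (S : Set (St → Prop)) (σ : St) : Set (St → Prop) :=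
  {p ∈ S | p σ}


theorem PosComb.mono_of_TS_subset {St : Type*} {S : Set (St → Prop)} {σ σ' : St}
    (h : TS S σ ⊆ TS S σ') {φ : St → Prop} (hφ : PosComb S φ) : φ σ → φ σ' := by
  induction hφ with
  | base hp => exact fun hσ => (h ⟨hp, hσ⟩).2
  | and _ _ ihp ihq => exact And.imp ihp ihq
  | or _ _ ihp ihq => exact Or.imp ihp ihq

/-- Along a wp-closed chain of bases, every basis predicate true in the serial state is true
in the interleaved view. -/
theorem TS_serial_subset_TS_interleaved {St : Type*} {n : ℕ} {f : ℕ → St → St}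
    {B : ℕ → Set (St → Prop)} {τ ρ : ℕ → St}
    (hwp : ∀ i < n, ∀ φ ∈ B (i + 1), PosComb (B i) (fun σ => φ (f i σ)))
    (h0 : TS (B 0) (ρ 0) ⊆ TS (B 0) (τ 0))
    (hτ : ∀ i < n, TS (B (i + 1)) (f i (τ i)) ⊆ TS (B (i + 1)) (τ (i + 1)))
    (hρ : ∀ i < n, ρ (i + 1) = f i (ρ i)) :
    ∀ i ≤ n, TS (B i) (ρ i) ⊆ TS (B i) (τ i) := by
  intro i
  induction i with
  | zero => exact fun _ => h0
  | succ i ih =>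
    rintro hi φ ⟨hφ, hφρ⟩
    rw [hρ i hi] at hφρ
    exact hτ i hi ⟨hφ, (hwp i hi φ hφ).mono_of_TS_subset (ih (Nat.le_of_lt hi)) hφρ⟩

/-- Equality of return values: under the hypotheses of the feasibility-of-the-solo-run
lemma, if the basis `B n` covers the return statement (for every `c`, the predicate
`ret σ = c` is a positive boolean combination over `B n`), then the value returned in
the interleaved execution equals the value returned in the serial execution. -/
theorem return_values_equal {St α : Type*} (n : ℕ)
    (f : ℕ → St → St) (g : ℕ → St → Prop)
    (B : ℕ → Set (St → Prop)) (τ ρ : ℕ → St)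
    (hg : ∀ i < n, PosComb (B i) (g i) ∧ PosComb (B i) (fun σ => ¬ g i σ))
    (hwp : ∀ i < n, ∀ φ ∈ B (i + 1), PosComb (B i) (fun σ => φ (f i σ)))
    (h0 : TS (B 0) (ρ 0) ⊆ TS (B 0) (τ 0))
    (hτ : ∀ i < n, g i (τ i) ∧
      TS (B (i + 1)) (f i (τ i)) ⊆ TS (B (i + 1)) (τ (i + 1)))
    (hρ : ∀ i < n, ρ (i + 1) = f i (ρ i))
    (ret : St → α)
    (hret : ∀ c : α, PosComb (B n) (fun σ => ret σ = c)) :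
    ret (ρ n) = ret (τ n) := by
  have hsub := TS_serial_subset_TS_interleaved hwp h0 (fun i hi => (hτ i hi).2) hρ n le_rfl
  exact ((hret (ret (ρ n))).mono_of_TS_subset hsub rfl).symm
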